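/- If the invariant turbulations of a measurable pseudo-Anosov map F : Σ → Σ satisfy the tartan connection hypothesis, then F is ergodic with respect to μ: every Borel set A with F(A) = A has μ(A) ∈ {0, 1}. -/

import Mathlib

open MeasureTheory Set Function Topology Filter
open scoped ENNReal

noncomputable section

variable {S : Type} [TopologicalSpace S] [MeasurableSpace S]

/-- `d` is (the distance function of) a metric on `S` compatible with its topology. -/
def IsCompatibleMetric (S : Type) [TopologicalSpace S] (d : S → S → ℝ) : Prop :=
  (∀ x y, d x y = d y x) ∧ (∀ x y, d x y = 0 ↔ x = y) ∧
  (∀ x y z, d x z ≤ d x y + d y z) ∧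
  (∀ s : Set S, IsOpen s ↔ ∀ x ∈ s, ∃ ε > (0 : ℝ), ∀ y, d x y < ε → y ∈ s)

/-- An immersed line: a continuous injective image of `ℝ`. -/
def IsImmersedLine (ℓ : Set S) : Prop :=
  ∃ f : ℝ → S, Continuous f ∧ Function.Injective f ∧ Set.range f = ℓ

/-- `A` is a closed stream arc of the immersed line `ℓ` with endpoints `x` and `y`. -/
def IsArcIn (ℓ A : Set S) (x y : S) : Prop :=
  ∃ f : ℝ → S, Continuous f ∧ Function.Injective f ∧ Set.range f = ℓ ∧
    ∃ a b : ℝ, a ≤ b ∧ f a = x ∧ f b = y ∧ A = f '' Set.Icc a b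

/-- `A` is a closed stream arc of the immersed line `ℓ`. -/
def IsArc (ℓ A : Set S) : Prop := ∃ x y, IsArcIn ℓ A x y

/-- Topological transversality of two immersed lines at a point `x`: local pieces (arcs) of the
two lines through `x` are, in some chart around `x`, the two coordinate axes. -/
def TransverseAt (ℓ ℓ' : Set S) (x : S) : Prop :=
  ∃ α β : Set S, x ∈ α ∧ x ∈ β ∧ IsArc ℓ α ∧ IsArc ℓ' β ∧
    ∃ U : Set S, IsOpen U ∧ x ∈ U ∧ ∃ e : U ≃ₜ ℝ × ℝ,
      Subtype.val '' (⇑e ⁻¹' {p : ℝ × ℝ | p.2 = 0}) = α ∩ U ∧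
      Subtype.val '' (⇑e ⁻¹' {p : ℝ × ℝ | p.1 = 0}) = β ∩ U

/-- The (manifold) boundary of the surface `S`: points having no neighbourhood
homeomorphic to the plane. -/
def ManifoldBdry (S : Type) [TopologicalSpace S] : Set S :=
  {x : S | ¬ ∃ U : Set S, IsOpen U ∧ x ∈ U ∧ Nonempty (U ≃ₜ ℝ × ℝ)}

/-- An Oxtoby–Ulam (OU) measure on the compact surface `S`: Borel (via the ambient
`BorelSpace` assumption), non-atomic, positive on non-empty open sets, and vanishing on
the boundary of `S`. -/
structure IsOUMeasure (μ : Measure S) : Prop where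
  noAtoms : ∀ x : S, μ {x} = 0
  openPos : ∀ U : Set S, IsOpen U → U.Nonempty → 0 < μ U
  boundaryNull : μ (ManifoldBdry S) = 0

/-- A measured turbulation on `S` (with ambient measure `μ`): a partition of a full
`μ`-measure Borel subset of `S` into streamlines (immersed lines), together with an
OU measure on each streamline which is finite on closed stream arcs. -/
structure MeasuredTurbulation (μ : Measure S) where
  lines : Set (Set S)
  lines_immersed : ∀ ℓ ∈ lines, IsImmersedLine ℓ
  lines_disjoint : lines.PairwiseDisjoint id
  domain_borel : MeasurableSet (⋃₀ lines)
  domain_full : μ (⋃₀ lines) = 1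
  ν : Set S → Measure S
  ν_supported : ∀ ℓ ∈ lines, ν ℓ ℓᶜ = 0
  ν_nonatomic : ∀ ℓ ∈ lines, ∀ x : S, ν ℓ {x} = 0
  ν_arc_pos : ∀ ℓ ∈ lines, ∀ A : Set S, ∀ x y : S, IsArcIn ℓ A x y → x ≠ y → 0 < ν ℓ A
  ν_arc_finite : ∀ ℓ ∈ lines, ∀ A : Set S, ∀ x y : S, IsArcIn ℓ A x y → ν ℓ A < ⊤

namespace MeasuredTurbulation

variable {μ : Measure S}

/-- Tameness with respect to a given metric `d`: stream arcs of small stream measure are small. -/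
def TameWith (T : MeasuredTurbulation μ) (d : S → S → ℝ) : Prop :=
  ∀ ε : ℝ, 0 < ε → ∃ δ : ℝ, 0 < δ ∧
    ∀ ℓ ∈ T.lines, ∀ A : Set S, ∀ x y : S,
      IsArcIn ℓ A x y → T.ν ℓ A < ENNReal.ofReal δ → d x y < ε

/-- A measured turbulation is tame if it is tame with respect to (every, equivalently some)
metric on `S` compatible with its topology. -/
def Tame (T : MeasuredTurbulation μ) : Prop :=
  ∀ d : S → S → ℝ, IsCompatibleMetric S d → T.TameWith d

/-- Every streamline is dense in `S`. -/
def DenseStreamlines (T : MeasuredTurbulation μ) : Prop := ∀ ℓ ∈ T.lines, Dense ℓ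

/-- Two measured turbulations are transverse if almost every point lies on streamlines of both
which intersect transversely there. -/
def TransversePair (Ts Tu : MeasuredTurbulation μ) : Prop :=
  ∃ W : Set S, MeasurableSet W ∧ μ W = 1 ∧
    ∀ x ∈ W, ∃ ℓ ∈ Ts.lines, ∃ ℓ' ∈ Tu.lines, x ∈ ℓ ∧ x ∈ ℓ' ∧ TransverseAt ℓ ℓ' x

end MeasuredTurbulation

/-- A tartan for the (stable, unstable) pair of measured turbulations `(Ts, Tu)`. -/
structure Tartan {μ : Measure S} (Ts Tu : MeasuredTurbulation μ) where
  Rs : Set S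
  Ru : Set S
  borel_s : MeasurableSet Rs
  borel_u : MeasurableSet Ru
  fibs : Set (Set S)
  fibu : Set (Set S)
  fibs_disjoint : fibs.PairwiseDisjoint id
  fibu_disjoint : fibu.PairwiseDisjoint id
  fibs_cover : ⋃₀ fibs = Rs
  fibu_cover : ⋃₀ fibu = Ru
  /-- (a) every stable fiber meets every unstable fiber in exactly one point. -/
  inter_unique : ∀ A ∈ fibs, ∀ B ∈ fibu, ∃! z : S, z ∈ A ∩ B
  /-- The fibers are stream arcs of the corresponding turbulations, and (b) they can be
  oriented consistently: every stable fiber crosses the unstable fibers in the same order,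
  and vice versa. -/
  oriented : ∃ ords ordu : Set S → S → S → Prop,
    (∀ A ∈ fibs, ∃ ℓ ∈ Ts.lines, ∃ f : ℝ → S, Continuous f ∧ Function.Injective f ∧
        Set.range f = ℓ ∧ ∃ a b : ℝ, a ≤ b ∧ A = f '' Set.Icc a b ∧
        ∀ s ∈ Set.Icc a b, ∀ t ∈ Set.Icc a b, (ords A (f s) (f t) ↔ s ≤ t)) ∧
    (∀ B ∈ fibu, ∃ ℓ ∈ Tu.lines, ∃ f : ℝ → S, Continuous f ∧ Function.Injective f ∧
        Set.range f = ℓ ∧ ∃ a b : ℝ, a ≤ b ∧ B = f '' Set.Icc a b ∧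
        ∀ s ∈ Set.Icc a b, ∀ t ∈ Set.Icc a b, (ordu B (f s) (f t) ↔ s ≤ t)) ∧
    (∀ A ∈ fibs, ∀ A' ∈ fibs, ∀ B ∈ fibu, ∀ B' ∈ fibu,
      ∀ p ∈ A ∩ B, ∀ q ∈ A ∩ B', ∀ p' ∈ A' ∩ B, ∀ q' ∈ A' ∩ B',
        (ords A p q ↔ ords A' p' q')) ∧
    (∀ B ∈ fibu, ∀ B' ∈ fibu, ∀ A ∈ fibs, ∀ A' ∈ fibs,
      ∀ p ∈ B ∩ A, ∀ q ∈ B ∩ A', ∀ p' ∈ B' ∩ A, ∀ q' ∈ B' ∩ A',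
        (ordu B p q ↔ ordu B' p' q'))
  /-- (c) the stream measures of the fibers are bounded above. -/
  bounded : ∃ L : ℝ≥0∞, L < ⊤ ∧
    (∀ A ∈ fibs, ∀ ℓ ∈ Ts.lines, A ⊆ ℓ → Ts.ν ℓ A ≤ L) ∧
    (∀ B ∈ fibu, ∀ ℓ ∈ Tu.lines, B ⊆ ℓ → Tu.ν ℓ B ≤ L)
  /-- (d) `Rs ∪ Ru` is contained in an open topological disk. -/
  in_disk : ∃ U : Set S, IsOpen U ∧ Rs ∪ Ru ⊆ U ∧ Nonempty (U ≃ₜ ℝ × ℝ)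

namespace Tartan

variable {μ : Measure S} {Ts Tu : MeasuredTurbulation μ}

/-- The set `R^⋔` of tartan intersection points. -/
def core (R : Tartan Ts Tu) : Set S := R.Rs ∩ R.Ru

/-- The tartan `R` is compatible with the ambient measure `μ`: for all stable and unstable
fibers `𝔰`, `𝔲`, the bijection `ψ : E^𝔰 × E^𝔲 → R^⋔`, `(x, y) ↦ 𝔲(x) ⋔ 𝔰(y)`, is
bi-measurable and pushes `ν_𝔰 × ν_𝔲` forward to `μ` restricted to `R^⋔`. -/
def Compatible (R : Tartan Ts Tu) : Prop :=
  ∀ 𝔰 ∈ R.fibs, ∀ 𝔲 ∈ R.fibu,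
  ∀ ℓs ∈ Ts.lines, 𝔰 ⊆ ℓs → ∀ ℓu ∈ Tu.lines, 𝔲 ⊆ ℓu →
  ∃ ψ : S × S → S,
    (∀ x ∈ 𝔰 ∩ R.core, ∀ y ∈ 𝔲 ∩ R.core,
      ∀ B ∈ R.fibu, x ∈ B → ∀ A ∈ R.fibs, y ∈ A → ψ (x, y) ∈ B ∩ A) ∧
    Set.InjOn ψ ((𝔰 ∩ R.core) ×ˢ (𝔲 ∩ R.core)) ∧
    ψ '' ((𝔰 ∩ R.core) ×ˢ (𝔲 ∩ R.core)) = R.core ∧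
    Measurable ψ ∧
    (∀ E : Set (S × S), E ⊆ (𝔰 ∩ R.core) ×ˢ (𝔲 ∩ R.core) → MeasurableSet E →
      MeasurableSet (ψ '' E)) ∧
    Measure.map ψ (((Ts.ν ℓs).restrict (𝔰 ∩ R.core)).prod
      ((Tu.ν ℓu).restrict (𝔲 ∩ R.core))) = μ.restrict R.core

/-- Image of `B ⊆ E^𝔰` under the holonomy map `h_{𝔰,𝔰'} : E^𝔰 → E^{𝔰'}`, `x ↦ 𝔲(x) ⋔ 𝔰'`. -/
def holSS (R : Tartan Ts Tu) (𝔰' B : Set S) : Set S :=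
  {x' : S | ∃ x ∈ B, ∃ Bu ∈ R.fibu, x ∈ Bu ∧ x' ∈ Bu ∩ 𝔰'}

/-- Image of `B ⊆ E^𝔲` under the holonomy map `h_{𝔲,𝔲'} : E^𝔲 → E^{𝔲'}`, `y ↦ 𝔰(y) ⋔ 𝔲'`. -/
def holUU (R : Tartan Ts Tu) (𝔲' B : Set S) : Set S :=
  {y' : S | ∃ y ∈ B, ∃ A ∈ R.fibs, y ∈ A ∧ y' ∈ A ∩ 𝔲'}

/-- "`𝔲(x) ⋔ 𝔰(y) ∈ A`": the intersection point of the unstable fiber through `x` and the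
stable fiber through `y` belongs to `A`. -/
def sectMem (R : Tartan Ts Tu) (A : Set S) (x y : S) : Prop :=
  ∃ B ∈ R.fibu, x ∈ B ∧ ∃ C ∈ R.fibs, y ∈ C ∧ ∃ z ∈ B ∩ C, z ∈ A

/-- `ν_{𝔲(x)}(A ∩ 𝔲(x))`: the stream measure of `A` along the unstable fiber through `x`. -/
def fiberMeasU (R : Tartan Ts Tu) (A : Set S) (x : S) : ℝ≥0∞ :=
  ⨆ (B : Set S) (_ : B ∈ R.fibu) (_ : x ∈ B) (ℓ : Set S) (_ : ℓ ∈ Tu.lines) (_ : B ⊆ ℓ),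
    Tu.ν ℓ (A ∩ B)

/-- `ν_{𝔰(y)}(A ∩ 𝔰(y))`: the stream measure of `A` along the stable fiber through `y`. -/
def fiberMeasS (R : Tartan Ts Tu) (A : Set S) (y : S) : ℝ≥0∞ :=
  ⨆ (C : Set S) (_ : C ∈ R.fibs) (_ : y ∈ C) (ℓ : Set S) (_ : ℓ ∈ Ts.lines) (_ : C ⊆ ℓ),
    Ts.ν ℓ (A ∩ C)

end Tartan

/-- The union of the stable streamlines containing fibers of `R`. -/
def stableSaturation {μ : Measure S} {Ts Tu : MeasuredTurbulation μ} (R : Tartan Ts Tu) :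
    Set S :=
  ⋃₀ {ℓ : Set S | ℓ ∈ Ts.lines ∧ ∃ A ∈ R.fibs, A ⊆ ℓ}

/-- The union of the unstable streamlines containing fibers of `R`. -/
def unstableSaturation {μ : Measure S} {Ts Tu : MeasuredTurbulation μ} (R : Tartan Ts Tu) :
    Set S :=
  ⋃₀ {ℓ : Set S | ℓ ∈ Tu.lines ∧ ∃ B ∈ R.fibu, B ⊆ ℓ}

/-- The pair `(Ts, Tu)` is full: countably many compatible tartans cover a full measure
subset of `S`, and every non-empty open set contains a positive measure compatible tartan. -/
def FullPair {μ : Measure S} (Ts Tu : MeasuredTurbulation μ) : Prop :=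
  (∃ R : ℕ → Tartan Ts Tu, (∀ i, (R i).Compatible) ∧ μ (⋃ i, (R i).core) = 1) ∧
  (∀ U : Set S, IsOpen U → U.Nonempty →
    ∃ R : Tartan Ts Tu, R.Compatible ∧ 0 < μ R.core ∧ R.Rs ∪ R.Ru ⊆ U)

/-- `(Ts, Tu)` are measurable pseudo-Anosov turbulations: transverse, tame, full, with
dense streamlines. -/
def MPATurbulations {μ : Measure S} (Ts Tu : MeasuredTurbulation μ) : Prop :=
  Ts.TransversePair Tu ∧ Ts.Tame ∧ Tu.Tame ∧ FullPair Ts Tu ∧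
    Ts.DenseStreamlines ∧ Tu.DenseStreamlines

/-- `F` is a measurable pseudo-Anosov homeomorphism with invariant turbulations `(Ts, Tu)`
and dilatation `lam > 1`. -/
structure IsMPA (μ : Measure S) (F : S ≃ₜ S) (Ts Tu : MeasuredTurbulation μ)
    (lam : ℝ) : Prop where
  measurePreserving : MeasurePreserving (⇑F) μ μ
  one_lt_lam : 1 < lam
  turbulations : MPATurbulations Ts Tu
  stable_image : ∀ ℓ ∈ Ts.lines, ⇑F '' ℓ ∈ Ts.lines
  unstable_image : ∀ ℓ ∈ Tu.lines, ⇑F '' ℓ ∈ Tu.lines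
  stable_contract : ∀ ℓ ∈ Ts.lines, ∀ A : Set S, ∀ x y : S, IsArcIn ℓ A x y →
    Ts.ν (⇑F '' ℓ) (⇑F '' A) = (ENNReal.ofReal lam)⁻¹ * Ts.ν ℓ A
  unstable_expand : ∀ ℓ ∈ Tu.lines, ∀ A : Set S, ∀ x y : S, IsArcIn ℓ A x y →
    Tu.ν (⇑F '' ℓ) (⇑F '' A) = ENNReal.ofReal lam * Tu.ν ℓ A

/-- `x` is a (two-sided) density point of `D` along the streamline `ℓ` of `T`. -/
def DensityPtAlong {μ : Measure S} (T : MeasuredTurbulation μ) (ℓ D : Set S) (x : S) :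
    Prop :=
  ∀ ε : ℝ, 0 < ε → ∃ δ : ℝ, 0 < δ ∧ ∀ A : Set S, ∀ y : S,
    IsArcIn ℓ A x y → T.ν ℓ A < ENNReal.ofReal δ →
      (1 - ε) * (T.ν ℓ A).toReal ≤ (T.ν ℓ (A ∩ D)).toReal

/-- The set `den_k(R)` of level `k` density points of the tartan `R`. -/
def denSet {μ : Measure S} {Ts Tu : MeasuredTurbulation μ} (R : Tartan Ts Tu) :
    ℕ → Set S
  | 0 => R.core
  | k + 1 =>
    {x : S | x ∈ denSet R k ∧
      (∀ ℓ ∈ Ts.lines, x ∈ ℓ → DensityPtAlong Ts ℓ (denSet R k) x) ∧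
      (∀ ℓ ∈ Tu.lines, x ∈ ℓ → DensityPtAlong Tu ℓ (denSet R k) x)}

/-- The set `X_{δ,η}(R)`: points of `R^⋔` all of whose stable and unstable stream arcs of
measure less than `η` contain points of `R^⋔` in density at least `1 - δ`. -/
def Xset {μ : Measure S} {Ts Tu : MeasuredTurbulation μ} (R : Tartan Ts Tu)
    (δ η : ℝ) : Set S :=
  {x : S | x ∈ R.core ∧
    (∀ ℓ ∈ Ts.lines, x ∈ ℓ → ∀ A : Set S, ∀ y : S, IsArcIn ℓ A x y →
      Ts.ν ℓ A < ENNReal.ofReal η →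
        ENNReal.ofReal (1 - δ) * Ts.ν ℓ A ≤ Ts.ν ℓ (A ∩ R.core)) ∧
    (∀ ℓ ∈ Tu.lines, x ∈ ℓ → ∀ A : Set S, ∀ y : S, IsArcIn ℓ A x y →
      Tu.ν ℓ A < ENNReal.ofReal η →
        ENNReal.ofReal (1 - δ) * Tu.ν ℓ A ≤ Tu.ν ℓ (A ∩ R.core))}

/-- A regular tartan: for `y ∈ 𝔰(x) ∩ R^⋔` and `z ∈ 𝔲(x) ∩ R^⋔` at small stream distance
from `x`, all the fibers of the subtartan `R(y,z)` (the subarcs of stable fibers running from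
`𝔲(y)` to `𝔲(z) = 𝔲(x)`, and of unstable fibers running from `𝔰(y) = 𝔰(x)` to `𝔰(z)`)
are contained in `U`. -/
def Tartan.Regular {μ : Measure S} {Ts Tu : MeasuredTurbulation μ}
    (R : Tartan Ts Tu) : Prop :=
  ∀ x ∈ R.core, ∀ U ∈ 𝓝 x, ∃ δ : ℝ, 0 < δ ∧
    ∀ 𝔰x ∈ R.fibs, x ∈ 𝔰x → ∀ 𝔲x ∈ R.fibu, x ∈ 𝔲x →
    ∀ y ∈ 𝔰x ∩ R.core, ∀ z ∈ 𝔲x ∩ R.core,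
    (∀ ℓ ∈ Ts.lines, 𝔰x ⊆ ℓ → ∀ α : Set S, IsArcIn ℓ α x y →
      Ts.ν ℓ α < ENNReal.ofReal δ) →
    (∀ ℓ ∈ Tu.lines, 𝔲x ⊆ ℓ → ∀ α : Set S, IsArcIn ℓ α x z →
      Tu.ν ℓ α < ENNReal.ofReal δ) →
    ∀ 𝔲y ∈ R.fibu, y ∈ 𝔲y → ∀ 𝔰z ∈ R.fibs, z ∈ 𝔰z →
      ((∀ A ∈ R.fibs, ∀ p q : S, p ∈ A ∩ 𝔲y → q ∈ A ∩ 𝔲x →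
          ∀ ℓ ∈ Ts.lines, A ⊆ ℓ → ∀ α : Set S, IsArcIn ℓ α p q → α ⊆ U) ∧
       (∀ B ∈ R.fibu, ∀ p q : S, p ∈ B ∩ 𝔰x → q ∈ B ∩ 𝔰z →
          ∀ ℓ ∈ Tu.lines, B ⊆ ℓ → ∀ β : Set S, IsArcIn ℓ β p q → β ⊆ U))

/-- A (stable) bi-Lipschitz regular tartan: for some metric compatible with the topology of
`S` and some `K ≥ 1`, stream measure and distance are `K`-bi-Lipschitz comparable along
stable fibers. -/
def Tartan.StableBiLipschitzRegular {μ : Measure S} {Ts Tu : MeasuredTurbulation μ}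
    (R : Tartan Ts Tu) : Prop :=
  ∃ d : S → S → ℝ, IsCompatibleMetric S d ∧ ∃ K : ℝ, 1 ≤ K ∧
    ∀ 𝔰 ∈ R.fibs, ∀ x ∈ 𝔰, ∀ y ∈ 𝔰, ∀ ℓ ∈ Ts.lines, 𝔰 ⊆ ℓ →
      ∀ α : Set S, IsArcIn ℓ α x y →
        d x y / K ≤ (Ts.ν ℓ α).toReal ∧ (Ts.ν ℓ α).toReal ≤ K * d x y

/-- The turbulation `T` has partial flowboxes: if `x` and `y` lie on the same streamline
`ℓ`, and arcs transverse to `ℓ` at `x` and `y` contain transverse intersections with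
streamlines of `T` arbitrarily close to `x` and `y` on the same side of `ℓ`, then every
neighbourhood `U` of the stream arc `[x,y]` contains other stream arcs with endpoints on the
two transversals.  (The transversals and the side are encoded via a chart straightening the
streamline.) -/
def HasPartialFlowboxes {μ : Measure S} (T : MeasuredTurbulation μ) : Prop :=
  ∀ ℓ ∈ T.lines, ∀ x y : S, ∀ A : Set S, IsArcIn ℓ A x y →
  ∀ V : Set S, IsOpen V → ∀ e : V ≃ₜ ℝ × ℝ, A ⊆ V →
  (Subtype.val '' (⇑e ⁻¹' {p : ℝ × ℝ | p.2 = 0}) ⊆ ℓ) →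
  (∃ hx : x ∈ V, e ⟨x, hx⟩ = (0, 0)) →
  (∃ hy : y ∈ V, e ⟨y, hy⟩ = (1, 0)) →
  (∀ ε : ℝ, 0 < ε → ∃ p : S, ∃ hp : p ∈ V,
      (e ⟨p, hp⟩).1 = 0 ∧ 0 < (e ⟨p, hp⟩).2 ∧ (e ⟨p, hp⟩).2 < ε ∧
      ∃ ℓ' ∈ T.lines, p ∈ ℓ' ∧
        TransverseAt ℓ' (Subtype.val '' (⇑e ⁻¹' {q : ℝ × ℝ | q.1 = 0})) p) →
  (∀ ε : ℝ, 0 < ε → ∃ p : S, ∃ hp : p ∈ V,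
      (e ⟨p, hp⟩).1 = 1 ∧ 0 < (e ⟨p, hp⟩).2 ∧ (e ⟨p, hp⟩).2 < ε ∧
      ∃ ℓ' ∈ T.lines, p ∈ ℓ' ∧
        TransverseAt ℓ' (Subtype.val '' (⇑e ⁻¹' {q : ℝ × ℝ | q.1 = 1})) p) →
  ∀ U : Set S, IsOpen U → A ⊆ U →
    ∃ ℓ'' ∈ T.lines, ∃ A'' : Set S, ∃ x'' y'' : S, IsArcIn ℓ'' A'' x'' y'' ∧
      A'' ⊆ U ∧ A'' ≠ A ∧
      x'' ∈ Subtype.val '' (⇑e ⁻¹' {q : ℝ × ℝ | q.1 = 0}) ∧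
      y'' ∈ Subtype.val '' (⇑e ⁻¹' {q : ℝ × ℝ | q.1 = 1})

/-- Forward Birkhoff averages of `φ` under the homeomorphism `F`. -/
def birkhoffFwd (F : S ≃ₜ S) (φ : S → ℝ) (x : S) (n : ℕ) : ℝ :=
  (n : ℝ)⁻¹ * ∑ i ∈ Finset.range n, φ ((⇑F)^[i] x)

/-- Backward Birkhoff averages of `φ` under the homeomorphism `F`. -/
def birkhoffBwd (F : S ≃ₜ S) (φ : S → ℝ) (x : S) (n : ℕ) : ℝ :=
  (n : ℝ)⁻¹ * ∑ i ∈ Finset.range n, φ ((⇑F.symm)^[i] x)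

/-- The set `Z` of points where the forward and backward Birkhoff averages of `φ` exist
and are equal. -/
def ZSet (F : S ≃ₜ S) (φ : S → ℝ) : Set S :=
  {x : S | ∃ c : ℝ, Tendsto (birkhoffFwd F φ x) atTop (𝓝 c) ∧
      Tendsto (birkhoffBwd F φ x) atTop (𝓝 c)}

/-- The relation `~` on `Z`: `x ~ y` if they are joined by a finite chain of stream arcs
whose consecutive intersections contain points of `Z`. -/
def StreamRel {μ : Measure S} (Ts Tu : MeasuredTurbulation μ) (F : S ≃ₜ S)
    (φ : S → ℝ) (x y : S) : Prop :=
  x ∈ ZSet F φ ∧ y ∈ ZSet F φ ∧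
  (x = y ∨ ∃ k : ℕ, ∃ α : Fin (k + 1) → Set S,
    (∀ i, (∃ ℓ ∈ Ts.lines, IsArc ℓ (α i)) ∨ (∃ ℓ ∈ Tu.lines, IsArc ℓ (α i))) ∧
    x ∈ α 0 ∧ y ∈ α (Fin.last k) ∧
    ∀ i : Fin k, ∃ z ∈ α i.castSucc ∩ α i.succ, z ∈ ZSet F φ)

/-- `B` is a union of members of `L`, apart from points lying on no member of `L`. -/
def IsSaturated {X : Type} (L : Set (Set X)) (B : Set X) : Prop :=
  ∀ ℓ ∈ L, ∀ x ∈ ℓ, ∀ y ∈ ℓ, x ∈ B → y ∈ B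

lemma IsArcIn.image {X : Type} [TopologicalSpace X] {ℓ A : Set X} {x y : X}
    (h : IsArcIn ℓ A x y) (G : X ≃ₜ X) :
    IsArcIn (⇑G '' ℓ) (⇑G '' A) (G x) (G y) := by
  obtain ⟨f, hf, hi, hr, a, b, hab, rfl, rfl, rfl⟩ := h
  refine ⟨G ∘ f, G.continuous.comp hf, G.injective.comp hi, ?_, a, b, hab, rfl, rfl, ?_⟩
  · rw [Set.range_comp, hr]
  · rw [Set.image_comp]

lemma IsImmersedLine.exists_arc {X : Type} [TopologicalSpace X] {ℓ : Set X}
    (h : IsImmersedLine ℓ) {x y : X} (hx : x ∈ ℓ) (hy : y ∈ ℓ) : ∃ A, IsArcIn ℓ A x y ∨ IsArcIn ℓ A y x := by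
  obtain ⟨f, hf, hi, rfl⟩ := h
  obtain ⟨a, rfl⟩ := hx
  obtain ⟨b, rfl⟩ := hy
  rcases le_total a b with hab | hab
  · exact ⟨_, Or.inl ⟨f, hf, hi, rfl, a, b, hab, rfl, rfl, rfl⟩⟩
  · exact ⟨_, Or.inr ⟨f, hf, hi, rfl, b, a, hab, rfl, rfl, rfl⟩⟩

lemma isCompatibleMetric_dist (X : Type) [MetricSpace X] :
    IsCompatibleMetric X (fun x y => dist x y) := by
  refine ⟨dist_comm, fun x y => dist_eq_zero, dist_triangle, fun s => ?_⟩
  rw [Metric.isOpen_iff]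
  simp only [Set.subset_def, Metric.mem_ball, dist_comm]

/-- On short stream arcs of a tame turbulation a continuous function varies little. -/
lemma MeasuredTurbulation.Tame.exists_modulus [CompactSpace S]
    [TopologicalSpace.MetrizableSpace S] {μ : Measure S} {T : MeasuredTurbulation μ}
    (hT : T.Tame) {φ : S → ℝ} (hφ : Continuous φ) {ε : ℝ} (hε : 0 < ε) :
    ∃ δ : ℝ, 0 < δ ∧ ∀ ℓ ∈ T.lines, ∀ A : Set S, ∀ x y : S, IsArcIn ℓ A x y →
      T.ν ℓ A < ENNReal.ofReal δ → |φ x - φ y| < ε := by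
  let := TopologicalSpace.metrizableSpaceMetric S
  obtain ⟨η, hη, h⟩ := Metric.uniformContinuous_iff.1
    (CompactSpace.uniformContinuous_of_continuous hφ) ε hε
  obtain ⟨δ, hδ, h'⟩ := hT _ (isCompatibleMetric_dist S) η hη
  exact ⟨δ, hδ, fun ℓ hℓ A x y hA hm => h (h' ℓ hℓ A x y hA hm)⟩

/-- The Hopf argument: an invariant Borel set agrees almost everywhere with a Borel set which is
saturated by the streamlines contracted by `G`. -/
lemma exists_saturated_ae_eq [T2Space S] [CompactSpace S]
    [TopologicalSpace.MetrizableSpace S] [BorelSpace S] {μ : Measure S} [IsProbabilityMeasure μ]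
    {T : MeasuredTurbulation μ} (hT : T.Tame) {G : S → S} (hGc : Continuous G)
    (hG : MeasurePreserving G μ μ) {lam : ℝ} (hlam : 1 < lam) {L : Set (Set S)}
    (hL : L ⊆ T.lines)
    (hcontr : ∀ ℓ ∈ L, ∀ A x y, IsArcIn ℓ A x y → ∀ n : ℕ, ∃ ℓ' ∈ T.lines, ∃ A',
      IsArcIn ℓ' A' (G^[n] x) (G^[n] y) ∧ T.ν ℓ' A' = (ENNReal.ofReal lam)⁻¹ ^ n * T.ν ℓ A)
    {A : Set S} (hA : MeasurableSet A) (hinv : G ⁻¹' A = A) :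
    ∃ B, MeasurableSet B ∧ B =ᵐ[μ] A ∧ IsSaturated L B := by
  set χ : S → ℝ := A.indicator 1 with hχ
  have hχm : Measurable χ := measurable_one.indicator hA
  have hχi : Integrable χ μ := (integrable_const (1 : ℝ)).indicator hA
  have hχG : ∀ n x, χ (G^[n] x) = χ x := by
    intro n
    induction n with
    | zero => intro x; rfl
    | succ n ih =>
      intro x
      rw [Function.iterate_succ_apply, ih]
      have : G x ∈ A ↔ x ∈ A := by
        rw [← Set.mem_preimage, hinv]
      by_cases hx : x ∈ A <;> simp [hχ, this, hx]
  obtain ⟨ε, hε, hεs⟩ := ENNReal.exists_pos_sum_of_countable' one_ne_zero ℕ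
  have hφ : ∀ k, ∃ φ : BoundedContinuousFunction S ℝ,
      ∫⁻ x, ‖χ x - φ x‖ₑ ∂μ ≤ ε k ∧ Integrable φ μ :=
    fun k => hχi.exists_boundedContinuous_lintegral_sub_le (hε k).ne'
  choose φ hφ _ using hφ
  have hmod : ∀ k : ℕ, ∃ δ : ℝ, 0 < δ ∧ ∀ ℓ ∈ T.lines, ∀ A : Set S, ∀ x y : S,
      IsArcIn ℓ A x y → T.ν ℓ A < ENNReal.ofReal δ → |φ k x - φ k y| < 1 / ((k : ℝ) + 1) :=
    fun k => hT.exists_modulus (φ k).continuous (by positivity)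
  choose δ hδ hmod using hmod
  have hn : ∀ k : ℕ, ∃ n : ℕ, (ENNReal.ofReal lam)⁻¹ ^ n * k < ENNReal.ofReal (δ k) := by
    intro k
    have hl : (ENNReal.ofReal lam)⁻¹ < 1 := by
      rw [ENNReal.inv_lt_one]
      simpa using hlam
    have ht := ENNReal.Tendsto.mul_const (b := (k : ℝ≥0∞))
      (ENNReal.tendsto_pow_atTop_nhds_zero_of_lt_one hl) (Or.inr (ENNReal.natCast_ne_top k))
    rw [zero_mul] at ht
    exact (ht.eventually_lt_const (ENNReal.ofReal_pos.2 (hδ k))).exists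
  choose n hn using hn
  set g : ℕ → S → ℝ := fun k x => φ k (G^[n k] x) with hg
  have hgm : ∀ k, Measurable (g k) := fun k =>
    ((φ k).continuous.comp (hGc.iterate _)).measurable
  have hclose : ∀ᵐ x ∂μ, Tendsto (fun k => g k x) atTop (𝓝 (χ x)) := by
    have hint : ∀ k, ∫⁻ x, ‖χ x - g k x‖ₑ ∂μ ≤ ε k := by
      intro k
      refine le_trans (le_of_eq ?_) (hφ k)
      have hm : Measurable fun x => ‖χ x - φ k x‖ₑ :=
        (hχm.sub (φ k).continuous.measurable).enorm
      rw [← (hG.iterate (n k)).lintegral_comp hm]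
      simp only [hχG, hg]
    have hm : ∀ k, Measurable fun x => ‖χ x - g k x‖ₑ := fun k => (hχm.sub (hgm k)).enorm
    have hfin : ∫⁻ x, ∑' k, ‖χ x - g k x‖ₑ ∂μ ≠ ⊤ := by
      rw [lintegral_tsum fun k => (hm k).aemeasurable]
      exact ((ENNReal.tsum_le_tsum hint).trans_lt (hεs.trans ENNReal.one_lt_top)).ne
    filter_upwards [ae_lt_top (Measurable.tsum hm) hfin] with x hx
    have h0 := ENNReal.tendsto_atTop_zero_of_tsum_ne_top hx.ne
    rw [tendsto_iff_edist_tendsto_0]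
    simpa only [edist_comm _ (χ x), edist_eq_enorm_sub] using h0
  refine ⟨{x | Tendsto (fun k => g k x) atTop (𝓝 1)}, measurableSet_tendsto _ hgm, ?_, ?_⟩
  · filter_upwards [hclose] with x hx
    refine propext ⟨fun h => ?_, fun h => ?_⟩
    · by_contra hxA
      have h1 : χ x = 1 := tendsto_nhds_unique hx h
      rw [hχ, Set.indicator_of_notMem hxA] at h1
      exact zero_ne_one h1
    · have h1 : χ x = 1 := by rw [hχ, Set.indicator_of_mem h, Pi.one_apply]
      change Tendsto _ _ _
      rwa [h1] at hx
  · have key : ∀ ℓ ∈ L, ∀ C x y, IsArcIn ℓ C x y →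
        Tendsto (fun k => g k x - g k y) atTop (𝓝 0) := by
      intro ℓ hℓ C x y hC
      obtain ⟨N, hN⟩ := ENNReal.exists_nat_gt (T.ν_arc_finite ℓ (hL hℓ) C x y hC).ne
      refine squeeze_zero_norm' ?_ tendsto_one_div_add_atTop_nhds_zero_nat
      filter_upwards [eventually_ge_atTop N] with k hk
      obtain ⟨ℓ', hℓ', C', hC', hν⟩ := hcontr ℓ hℓ C x y hC (n k)
      refine (hmod k ℓ' hℓ' C' _ _ hC' ?_).le
      rw [hν]
      refine lt_of_le_of_lt ?_ (hn k)
      gcongr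
      exact hN.le.trans (by exact_mod_cast hk)
    intro ℓ hℓ x hx y hy hxB
    obtain ⟨C, hC | hC⟩ := (T.lines_immersed ℓ (hL hℓ)).exists_arc hx hy
    · simpa using Tendsto.sub hxB (key ℓ hℓ C x y hC)
    · simpa using Tendsto.add hxB (key ℓ hℓ C y x hC)

namespace Tartan

variable {μ : Measure S} {Ts Tu : MeasuredTurbulation μ}

lemma exists_arc_of_mem_fibs (R : Tartan Ts Tu) {A : Set S} (hA : A ∈ R.fibs) :
    ∃ ℓ ∈ Ts.lines, A ⊆ ℓ ∧ IsArc ℓ A := by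
  obtain ⟨_, _, h, -⟩ := R.oriented
  obtain ⟨ℓ, hℓ, f, hf, hi, rfl, a, b, hab, rfl, -⟩ := h A hA
  exact ⟨_, hℓ, Set.image_subset_range _ _, _, _, f, hf, hi, rfl, a, b, hab, rfl, rfl, rfl⟩

lemma exists_arc_of_mem_fibu (R : Tartan Ts Tu) {B : Set S} (hB : B ∈ R.fibu) :
    ∃ ℓ ∈ Tu.lines, B ⊆ ℓ ∧ IsArc ℓ B := by
  obtain ⟨_, _, -, h, -⟩ := R.oriented
  obtain ⟨ℓ, hℓ, f, hf, hi, rfl, a, b, hab, rfl, -⟩ := h B hB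
  exact ⟨_, hℓ, Set.image_subset_range _ _, _, _, f, hf, hi, rfl, a, b, hab, rfl, rfl, rfl⟩

/-- The subtartan consisting of all unstable fibers and of the stable fibers inside `B`. -/
def restrictS (R : Tartan Ts Tu) {B : Set S} (hB : MeasurableSet B)
    (hsat : IsSaturated Ts.lines B) : Tartan Ts Tu where
  Rs := R.Rs ∩ B
  Ru := R.Ru
  borel_s := R.borel_s.inter hB
  borel_u := R.borel_u
  fibs := {A ∈ R.fibs | A ⊆ B}
  fibu := R.fibu
  fibs_disjoint := R.fibs_disjoint.subset (Set.sep_subset _ _)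
  fibu_disjoint := R.fibu_disjoint
  fibs_cover := by
    refine Set.Subset.antisymm ?_ ?_
    · rintro x ⟨A, ⟨hA, hAB⟩, hx⟩
      exact ⟨R.fibs_cover ▸ ⟨A, hA, hx⟩, hAB hx⟩
    · rintro x ⟨hxR, hxB⟩
      rw [← R.fibs_cover] at hxR
      obtain ⟨A, hA, hx⟩ := hxR
      obtain ⟨ℓ, hℓ, hAℓ, -⟩ := R.exists_arc_of_mem_fibs hA
      exact ⟨A, ⟨hA, fun y hy => hsat ℓ hℓ x (hAℓ hx) y (hAℓ hy) hxB⟩, hx⟩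
  fibu_cover := R.fibu_cover
  inter_unique A hA := R.inter_unique A hA.1
  oriented := by
    obtain ⟨os, ou, h1, h2, h3, h4⟩ := R.oriented
    exact ⟨os, ou, fun A hA => h1 A hA.1, h2, fun A hA A' hA' => h3 A hA.1 A' hA'.1,
      fun B hB B' hB' A hA A' hA' => h4 B hB B' hB' A hA.1 A' hA'.1⟩
  bounded := by
    obtain ⟨L, hL, h1, h2⟩ := R.bounded
    exact ⟨L, hL, fun A hA => h1 A hA.1, h2⟩
  in_disk := by
    obtain ⟨U, hU, h, e⟩ := R.in_disk
    exact ⟨U, hU, (Set.union_subset_union_left _ Set.inter_subset_left).trans h, e⟩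

/-- The subtartan consisting of all stable fibers and of the unstable fibers inside `B`. -/
def restrictU (R : Tartan Ts Tu) {B : Set S} (hB : MeasurableSet B)
    (hsat : IsSaturated Tu.lines B) : Tartan Ts Tu where
  Rs := R.Rs
  Ru := R.Ru ∩ B
  borel_s := R.borel_s
  borel_u := R.borel_u.inter hB
  fibs := R.fibs
  fibu := {A ∈ R.fibu | A ⊆ B}
  fibs_disjoint := R.fibs_disjoint
  fibu_disjoint := R.fibu_disjoint.subset (Set.sep_subset _ _)
  fibs_cover := R.fibs_cover
  fibu_cover := by
    refine Set.Subset.antisymm ?_ ?_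
    · rintro x ⟨A, ⟨hA, hAB⟩, hx⟩
      exact ⟨R.fibu_cover ▸ ⟨A, hA, hx⟩, hAB hx⟩
    · rintro x ⟨hxR, hxB⟩
      rw [← R.fibu_cover] at hxR
      obtain ⟨A, hA, hx⟩ := hxR
      obtain ⟨ℓ, hℓ, hAℓ, -⟩ := R.exists_arc_of_mem_fibu hA
      exact ⟨A, ⟨hA, fun y hy => hsat ℓ hℓ x (hAℓ hx) y (hAℓ hy) hxB⟩, hx⟩
  inter_unique A hA C hC := R.inter_unique A hA C hC.1
  oriented := by
    obtain ⟨os, ou, h1, h2, h3, h4⟩ := R.oriented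
    exact ⟨os, ou, h1, fun A hA => h2 A hA.1,
      fun B hB B' hB' A hA A' hA' => h3 B hB B' hB' A hA.1 A' hA'.1,
      fun A hA A' hA' => h4 A hA.1 A' hA'.1⟩
  bounded := by
    obtain ⟨L, hL, h1, h2⟩ := R.bounded
    exact ⟨L, hL, h1, fun A hA => h2 A hA.1⟩
  in_disk := by
    obtain ⟨U, hU, h, e⟩ := R.in_disk
    exact ⟨U, hU, (Set.union_subset_union_right _ Set.inter_subset_left).trans h, e⟩

lemma core_restrictS (R : Tartan Ts Tu) {B : Set S} (hB : MeasurableSet B)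
    (hsat : IsSaturated Ts.lines B) : (R.restrictS hB hsat).core = R.core ∩ B :=
  Set.inter_right_comm _ _ _

lemma core_restrictU (R : Tartan Ts Tu) {B : Set S} (hB : MeasurableSet B)
    (hsat : IsSaturated Tu.lines B) : (R.restrictU hB hsat).core = R.core ∩ B :=
  (Set.inter_assoc _ _ _).symm

lemma measurableSet_core (R : Tartan Ts Tu) : MeasurableSet R.core :=
  R.borel_s.inter R.borel_u

end Tartan

lemma IsArc.isCompact {X : Type} [TopologicalSpace X] {ℓ A : Set X} (h : IsArc ℓ A) : IsCompact A := by
  obtain ⟨x, y, f, hf, -, -, a, b, -, -, -, rfl⟩ := h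
  exact isCompact_Icc.image hf

/-- A product parametrisation of a measure restricts to a saturated subset. -/
lemma map_prod_restrict_inter {X : Type*} [MeasurableSpace X] {μ ν₁ ν₂ : Measure X}
    {ψ : X × X → X} (hψ : Measurable ψ) {E₁ E₂ E₁' E₂' C B : Set X} (hE₁ : MeasurableSet E₁) (hE₂ : MeasurableSet E₂)
    (hB : MeasurableSet B) (hf₁ : ν₁ E₁ ≠ ⊤) (hf₂ : ν₂ E₂ ≠ ⊤) (hs₁ : E₁' ⊆ E₁)
    (hs₂ : E₂' ⊆ E₂)
    (hpre : ∀ p ∈ E₁ ×ˢ E₂, ψ p ∈ B ↔ p ∈ E₁' ×ˢ E₂')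
    (hmap : Measure.map ψ ((ν₁.restrict E₁).prod (ν₂.restrict E₂)) = μ.restrict C) :
    Measure.map ψ ((ν₁.restrict E₁').prod (ν₂.restrict E₂')) = μ.restrict (C ∩ B) := by
  have : IsFiniteMeasure (ν₁.restrict E₁) := ⟨by simpa using hf₁.lt_top⟩
  have : IsFiniteMeasure (ν₂.restrict E₂) := ⟨by simpa using hf₂.lt_top⟩
  have h₁ : ν₁.restrict E₁' = (ν₁.restrict E₁).restrict E₁' :=
    (Measure.restrict_restrict_of_subset hs₁).symm
  have h₂ : ν₂.restrict E₂' = (ν₂.restrict E₂).restrict E₂' :=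
    (Measure.restrict_restrict_of_subset hs₂).symm
  have hE : ∀ᵐ p ∂(ν₁.restrict E₁).prod (ν₂.restrict E₂), p ∈ E₁ ×ˢ E₂ := by
    have : (ν₁.restrict E₁).prod (ν₂.restrict E₂) =
        ((ν₁.restrict E₁).prod (ν₂.restrict E₂)).restrict (E₁ ×ˢ E₂) := by
      rw [← Measure.prod_restrict, Measure.restrict_restrict_of_subset subset_rfl,
        Measure.restrict_restrict_of_subset subset_rfl]
    rw [this]
    exact ae_restrict_mem (hE₁.prod hE₂)
  have hae : (E₁' ×ˢ E₂' : Set (X × X)) =ᵐ[(ν₁.restrict E₁).prod (ν₂.restrict E₂)] ψ ⁻¹' B := by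
    filter_upwards [hE] with p hp
    exact propext (hpre p hp).symm
  rw [h₁, h₂, Measure.prod_restrict, Measure.restrict_congr_set hae,
    ← Measure.restrict_map hψ hB, hmap, Measure.restrict_restrict hB, Set.inter_comm]

namespace Tartan

variable {μ : Measure S} {Ts Tu : MeasuredTurbulation μ}

lemma Compatible.restrictS [T2Space S] [BorelSpace S] {R : Tartan Ts Tu} (hR : R.Compatible)
    {B : Set S} (hB : MeasurableSet B) (hsat : IsSaturated Ts.lines B) :
    (R.restrictS hB hsat).Compatible := by
  rintro s ⟨hs, hsB⟩ u hu ℓs hℓs hsℓ ℓu hℓu huℓ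
  obtain ⟨ψ, h1, h2, h3, h4, h5, h6⟩ := hR s hs u hu ℓs hℓs hsℓ ℓu hℓu huℓ
  rw [core_restrictS]
  have hEs : s ∩ (R.core ∩ B) = s ∩ R.core := by
    rw [Set.inter_comm R.core, ← Set.inter_assoc, Set.inter_eq_left.2 hsB]
  have hEu : u ∩ (R.core ∩ B) ⊆ u ∩ R.core :=
    Set.inter_subset_inter_right _ Set.inter_subset_left
  have hpre : ∀ p ∈ (s ∩ R.core) ×ˢ (u ∩ R.core),
      (ψ p ∈ B ↔ p ∈ (s ∩ (R.core ∩ B)) ×ˢ (u ∩ (R.core ∩ B))) := by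
    rintro ⟨x, y⟩ ⟨hx, hy⟩
    obtain ⟨C, hC, hxC⟩ : x ∈ ⋃₀ R.fibu := R.fibu_cover ▸ hx.2.2
    obtain ⟨D, hD, hyD⟩ : y ∈ ⋃₀ R.fibs := R.fibs_cover ▸ hy.2.1
    obtain ⟨ℓ, hℓ, hDℓ, -⟩ := R.exists_arc_of_mem_fibs hD
    have hψD := (h1 x hx y hy C hC hxC D hD hyD).2
    rw [hEs]
    exact ⟨fun h => ⟨hx, hy.1, hy.2, hsat ℓ hℓ _ (hDℓ hψD) y (hDℓ hyD) h⟩,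
      fun h => hsat ℓ hℓ y (hDℓ hyD) _ (hDℓ hψD) h.2.2.2⟩
  have hsub : (s ∩ (R.core ∩ B)) ×ˢ (u ∩ (R.core ∩ B)) ⊆ (s ∩ R.core) ×ˢ (u ∩ R.core) :=
    Set.prod_mono hEs.subset hEu
  refine ⟨ψ, fun x hx y hy C hC hxC D hD hyD =>
    h1 x (hEs ▸ hx) y (hEu hy) C hC hxC D hD.1 hyD, h2.mono hsub, ?_, h4,
    fun E hE => h5 E (hE.trans hsub), ?_⟩
  · refine Set.Subset.antisymm ?_ ?_
    · rintro _ ⟨p, hp, rfl⟩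
      exact ⟨h3 ▸ Set.mem_image_of_mem ψ (hsub hp), (hpre p (hsub hp)).2 hp⟩
    · rintro z ⟨hz, hzB⟩
      rw [← h3] at hz
      obtain ⟨p, hp, rfl⟩ := hz
      exact ⟨p, (hpre p hp).1 hzB, rfl⟩
  · obtain ⟨L, hL, hbs, hbu⟩ := R.bounded
    obtain ⟨_, _, _, has⟩ := R.exists_arc_of_mem_fibs hs
    obtain ⟨_, _, _, hau⟩ := R.exists_arc_of_mem_fibu hu
    exact map_prod_restrict_inter h4 (has.isCompact.measurableSet.inter R.measurableSet_core)
      (hau.isCompact.measurableSet.inter R.measurableSet_core) hB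
      ((measure_mono Set.inter_subset_left).trans (hbs s hs ℓs hℓs hsℓ) |>.trans_lt hL).ne
      ((measure_mono Set.inter_subset_left).trans (hbu u hu ℓu hℓu huℓ) |>.trans_lt hL).ne
      hEs.subset hEu hpre h6

lemma Compatible.restrictU [T2Space S] [BorelSpace S] {R : Tartan Ts Tu} (hR : R.Compatible)
    {B : Set S} (hB : MeasurableSet B) (hsat : IsSaturated Tu.lines B) :
    (R.restrictU hB hsat).Compatible := by
  rintro s hs u ⟨hu, huB⟩ ℓs hℓs hsℓ ℓu hℓu huℓ
  obtain ⟨ψ, h1, h2, h3, h4, h5, h6⟩ := hR s hs u hu ℓs hℓs hsℓ ℓu hℓu huℓ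
  rw [core_restrictU]
  have hEu : u ∩ (R.core ∩ B) = u ∩ R.core := by
    rw [Set.inter_comm R.core, ← Set.inter_assoc, Set.inter_eq_left.2 huB]
  have hEs : s ∩ (R.core ∩ B) ⊆ s ∩ R.core :=
    Set.inter_subset_inter_right _ Set.inter_subset_left
  have hpre : ∀ p ∈ (s ∩ R.core) ×ˢ (u ∩ R.core),
      (ψ p ∈ B ↔ p ∈ (s ∩ (R.core ∩ B)) ×ˢ (u ∩ (R.core ∩ B))) := by
    rintro ⟨x, y⟩ ⟨hx, hy⟩
    obtain ⟨C, hC, hxC⟩ : x ∈ ⋃₀ R.fibu := R.fibu_cover ▸ hx.2.2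
    obtain ⟨D, hD, hyD⟩ : y ∈ ⋃₀ R.fibs := R.fibs_cover ▸ hy.2.1
    obtain ⟨ℓ, hℓ, hCℓ, -⟩ := R.exists_arc_of_mem_fibu hC
    have hψC := (h1 x hx y hy C hC hxC D hD hyD).1
    rw [hEu]
    exact ⟨fun h => ⟨⟨hx.1, hx.2, hsat ℓ hℓ _ (hCℓ hψC) x (hCℓ hxC) h⟩, hy⟩,
      fun h => hsat ℓ hℓ x (hCℓ hxC) _ (hCℓ hψC) h.1.2.2⟩
  have hsub : (s ∩ (R.core ∩ B)) ×ˢ (u ∩ (R.core ∩ B)) ⊆ (s ∩ R.core) ×ˢ (u ∩ R.core) :=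
    Set.prod_mono hEs hEu.subset
  refine ⟨ψ, fun x hx y hy C hC hxC D hD hyD =>
    h1 x (hEs hx) y (hEu ▸ hy) C hC.1 hxC D hD hyD, h2.mono hsub, ?_, h4,
    fun E hE => h5 E (hE.trans hsub), ?_⟩
  · refine Set.Subset.antisymm ?_ ?_
    · rintro _ ⟨p, hp, rfl⟩
      exact ⟨h3 ▸ Set.mem_image_of_mem ψ (hsub hp), (hpre p (hsub hp)).2 hp⟩
    · rintro z ⟨hz, hzB⟩
      rw [← h3] at hz
      obtain ⟨p, hp, rfl⟩ := hz
      exact ⟨p, (hpre p hp).1 hzB, rfl⟩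
  · obtain ⟨L, hL, hbs, hbu⟩ := R.bounded
    obtain ⟨_, _, _, has⟩ := R.exists_arc_of_mem_fibs hs
    obtain ⟨_, _, _, hau⟩ := R.exists_arc_of_mem_fibu hu
    exact map_prod_restrict_inter h4 (has.isCompact.measurableSet.inter R.measurableSet_core)
      (hau.isCompact.measurableSet.inter R.measurableSet_core) hB
      ((measure_mono Set.inter_subset_left).trans (hbs s hs ℓs hℓs hsℓ) |>.trans_lt hL).ne
      ((measure_mono Set.inter_subset_left).trans (hbu u hu ℓu hℓu huℓ) |>.trans_lt hL).ne
      hEs hEu.subset hpre h6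

lemma stableSaturation_restrictS_subset (R : Tartan Ts Tu) {B : Set S} (hB : MeasurableSet B)
    (hsat : IsSaturated Ts.lines B) (hne : (R.restrictS hB hsat).core.Nonempty) :
    stableSaturation (R.restrictS hB hsat) ⊆ B := by
  rintro x ⟨ℓ, ⟨hℓ, A, ⟨hA, hAB⟩, hAℓ⟩, hx⟩
  obtain ⟨z, -, hz⟩ := hne
  obtain ⟨C, hC, -⟩ : z ∈ ⋃₀ R.fibu := R.fibu_cover ▸ hz
  obtain ⟨w, ⟨hwA, -⟩, -⟩ := R.inter_unique A hA C hC
  exact hsat ℓ hℓ w (hAℓ hwA) x hx (hAB hwA)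

lemma unstableSaturation_restrictU_subset (R : Tartan Ts Tu) {B : Set S} (hB : MeasurableSet B)
    (hsat : IsSaturated Tu.lines B) (hne : (R.restrictU hB hsat).core.Nonempty) :
    unstableSaturation (R.restrictU hB hsat) ⊆ B := by
  rintro x ⟨ℓ, ⟨hℓ, A, ⟨hA, hAB⟩, hAℓ⟩, hx⟩
  obtain ⟨z, hz, -⟩ := hne
  obtain ⟨C, hC, -⟩ : z ∈ ⋃₀ R.fibs := R.fibs_cover ▸ hz
  obtain ⟨w, ⟨-, hwA⟩, -⟩ := R.inter_unique C hC A hA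
  exact hsat ℓ hℓ w (hAℓ hwA) x hx (hAB hwA)

end Tartan

lemma IsSaturated.compl {X : Type} {L : Set (Set X)} {B : Set X} (h : IsSaturated L B) :
    IsSaturated L Bᶜ :=
  fun ℓ hℓ x hx y hy hxB hyB => hxB (h ℓ hℓ y hy x hx hyB)

/-- Under the tartan connection hypothesis, a stably saturated set of positive measure and an
unstably saturated set of positive measure meet in a set of positive measure. -/
lemma measure_inter_pos_of_tartan_connection [T2Space S] [BorelSpace S] {μ : Measure S}
    [IsProbabilityMeasure μ] {Ts Tu : MeasuredTurbulation μ} (hfull : FullPair Ts Tu)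
    (htch : ∀ R Q : Tartan Ts Tu, R.Compatible → 0 < μ R.core →
      Q.Compatible → 0 < μ Q.core → 0 < μ (stableSaturation R ∩ unstableSaturation Q))
    {B C : Set S} (hB : MeasurableSet B) (hBs : IsSaturated Ts.lines B) (hB0 : μ B ≠ 0)
    (hC : MeasurableSet C) (hCs : IsSaturated Tu.lines C) (hC0 : μ C ≠ 0) :
    0 < μ (B ∩ C) := by
  obtain ⟨⟨R, hR, hcov⟩, -⟩ := hfull
  have hex : ∀ D : Set S, μ D ≠ 0 → ∃ i, 0 < μ ((R i).core ∩ D) := by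
    intro D hD
    by_contra! h
    refine hD ?_
    have hnull : μ ((⋃ i, (R i).core) ∩ D) = 0 := by
      rw [Set.iUnion_inter, measure_iUnion_null_iff]
      exact fun i => le_antisymm (h i) bot_le
    have hco : μ (⋃ i, (R i).core)ᶜ = 0 :=
      (prob_compl_eq_zero_iff (MeasurableSet.iUnion fun i => (R i).measurableSet_core)).2 hcov
    refine measure_mono_null (fun x hx => ?_) (measure_union_null hnull hco)
    by_cases h : x ∈ ⋃ i, (R i).core
    · exact Or.inl ⟨h, hx⟩
    · exact Or.inr h
  obtain ⟨i, hi⟩ := hex B hB0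
  obtain ⟨j, hj⟩ := hex C hC0
  rw [← (R i).core_restrictS hB hBs] at hi
  rw [← (R j).core_restrictU hC hCs] at hj
  exact (htch _ _ ((hR i).restrictS hB hBs) hi ((hR j).restrictU hC hCs) hj).trans_le
    (measure_mono (Set.inter_subset_inter
      ((R i).stableSaturation_restrictS_subset hB hBs (nonempty_of_measure_ne_zero hi.ne'))
      ((R j).unstableSaturation_restrictU_subset hC hCs (nonempty_of_measure_ne_zero hj.ne'))))

namespace IsMPA

variable {μ : Measure S} {F : S ≃ₜ S} {Ts Tu : MeasuredTurbulation μ} {lam : ℝ}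

lemma exists_stable_arc_iterate (hF : IsMPA μ F Ts Tu lam) {ℓ A : Set S} {x y : S}
    (hℓ : ℓ ∈ Ts.lines) (hA : IsArcIn ℓ A x y) (n : ℕ) : ∃ ℓ' ∈ Ts.lines, ∃ A',
      IsArcIn ℓ' A' (F^[n] x) (F^[n] y) ∧
        Ts.ν ℓ' A' = (ENNReal.ofReal lam)⁻¹ ^ n * Ts.ν ℓ A := by
  induction n with
  | zero => exact ⟨ℓ, hℓ, A, hA, by simp⟩
  | succ n ih =>
    obtain ⟨ℓ', hℓ', A', hA', hν⟩ := ih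
    refine ⟨_, hF.stable_image ℓ' hℓ', F '' A', ?_, ?_⟩
    · simpa only [Function.iterate_succ_apply'] using hA'.image F
    · rw [hF.stable_contract ℓ' hℓ' A' _ _ hA', hν, pow_succ', mul_assoc]

/-- The unstable streamlines all of whose backward images are streamlines. -/
def backwardLines (F : S ≃ₜ S) (Tu : MeasuredTurbulation μ) : Set (Set S) :=
  {ℓ | ∀ n : ℕ, (F.symm : S → S)^[n] '' ℓ ∈ Tu.lines}

lemma backwardLines_subset : backwardLines F Tu ⊆ Tu.lines := fun ℓ hℓ => by
  simpa using hℓ 0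

lemma exists_unstable_arc_iterate (hF : IsMPA μ F Ts Tu lam) {ℓ A : Set S} {x y : S}
    (hℓ : ℓ ∈ backwardLines F Tu) (hA : IsArcIn ℓ A x y) (n : ℕ) : ∃ ℓ' ∈ Tu.lines, ∃ A',
      IsArcIn ℓ' A' (F.symm^[n] x) (F.symm^[n] y) ∧
        Tu.ν ℓ' A' = (ENNReal.ofReal lam)⁻¹ ^ n * Tu.ν ℓ A := by
  suffices h : IsArcIn (F.symm^[n] '' ℓ) (F.symm^[n] '' A) (F.symm^[n] x) (F.symm^[n] y) ∧
      Tu.ν (F.symm^[n] '' ℓ) (F.symm^[n] '' A) = (ENNReal.ofReal lam)⁻¹ ^ n * Tu.ν ℓ A from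
    ⟨_, hℓ n, _, h⟩
  induction n with
  | zero => simpa using hA
  | succ n ih =>
    obtain ⟨hA', hν⟩ := ih
    have hs : ∀ D : Set S, F.symm^[n + 1] '' D = F.symm '' (F.symm^[n] '' D) := fun D => by
      rw [Function.iterate_succ', Set.image_comp]
    have harc : IsArcIn (F.symm^[n + 1] '' ℓ) (F.symm^[n + 1] '' A)
        (F.symm^[n + 1] x) (F.symm^[n + 1] y) := by
      rw [hs, hs, Function.iterate_succ_apply', Function.iterate_succ_apply']
      exact hA'.image F.symm
    refine ⟨harc, ?_⟩
    have hFs : ∀ D : Set S, F '' (F.symm '' D) = D := fun D => by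
      rw [← Set.image_comp]; simp
    have h := hF.unstable_expand _ (hℓ (n + 1)) _ _ _ harc
    simp only [hs, hFs] at h
    rw [hν] at h
    have hl0 : ENNReal.ofReal lam ≠ 0 :=
      (ENNReal.ofReal_pos.2 (zero_lt_one.trans hF.one_lt_lam)).ne'
    rw [hs, hs, pow_succ', mul_assoc, h, ← mul_assoc,
      ENNReal.inv_mul_cancel hl0 ENNReal.ofReal_ne_top, one_mul]

lemma sUnion_backwardLines (hF : IsMPA μ F Ts Tu lam) :
    ⋃₀ backwardLines F Tu = ⋂ n : ℕ, (F.symm : S → S)^[n] ⁻¹' ⋃₀ Tu.lines := by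
  refine Set.Subset.antisymm ?_ ?_
  · rintro x ⟨ℓ, hℓ, hx⟩
    exact Set.mem_iInter.2 fun n => ⟨_, hℓ n, Set.mem_image_of_mem _ hx⟩
  · intro x hx
    rw [Set.mem_iInter] at hx
    obtain ⟨ℓ, hℓ, hxℓ⟩ := hx 0
    refine ⟨ℓ, fun n => ?_, hxℓ⟩
    obtain ⟨ℓ', hℓ', hxℓ'⟩ := hx n
    have hfwd : ∀ m : ℕ, (F : S → S)^[m] '' ℓ' ∈ Tu.lines := by
      intro m
      induction m with
      | zero => simpa using hℓ'
      | succ m ih =>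
        rw [Function.iterate_succ', Set.image_comp]
        exact hF.unstable_image _ ih
    have hinv : LeftInverse (F : S → S)^[n] (F.symm : S → S)^[n] :=
      Function.LeftInverse.iterate F.apply_symm_apply n
    have hinv' : LeftInverse (F.symm : S → S)^[n] (F : S → S)^[n] :=
      Function.LeftInverse.iterate F.symm_apply_apply n
    have heq : ℓ = (F : S → S)^[n] '' ℓ' :=
      Tu.lines_disjoint.elim_set hℓ (hfwd n) x hxℓ ⟨_, hxℓ', hinv x⟩
    rw [heq, ← Set.image_comp, hinv'.comp_eq_id, Set.image_id]
    exact hℓ'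

lemma measurePreserving_symm [BorelSpace S] (hF : IsMPA μ F Ts Tu lam) :
    MeasurePreserving F.symm μ μ :=
  MeasurePreserving.symm F.toMeasurableEquiv hF.measurePreserving

lemma measurableSet_sUnion_backwardLines [BorelSpace S] (hF : IsMPA μ F Ts Tu lam) :
    MeasurableSet (⋃₀ backwardLines F Tu) := by
  rw [hF.sUnion_backwardLines]
  exact MeasurableSet.iInter fun n => F.symm.continuous.measurable.iterate n Tu.domain_borel

lemma ae_mem_sUnion_backwardLines [BorelSpace S] [IsProbabilityMeasure μ]
    (hF : IsMPA μ F Ts Tu lam) : ∀ᵐ x ∂μ, x ∈ ⋃₀ backwardLines F Tu := by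
  rw [hF.sUnion_backwardLines]
  simp only [Set.mem_iInter]
  refine ae_all_iff.2 fun n => ?_
  exact (hF.measurePreserving_symm.iterate n).quasiMeasurePreserving.ae
    ((mem_ae_iff_prob_eq_one Tu.domain_borel).2 Tu.domain_full)

/-- The part of a set inside the backward invariant unstable streamlines is saturated as soon as
the set is saturated by these. -/
lemma isSaturated_inter_backwardLines {B : Set S} (hB : IsSaturated (backwardLines F Tu) B) :
    IsSaturated Tu.lines (B ∩ ⋃₀ backwardLines F Tu) := by
  rintro ℓ hℓ x hx y hy ⟨hxB, ℓ', hℓ', hx'⟩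
  obtain rfl : ℓ = ℓ' := Tu.lines_disjoint.elim_set hℓ (backwardLines_subset hℓ') x hx hx'
  exact ⟨hB ℓ hℓ' x hx y hy hxB, ℓ, hℓ', hy⟩

end IsMPA

/-- a measurable pseudo-Anosov map whose turbulations satisfy the tartan
connection hypothesis is ergodic with respect to μ. -/
theorem mpa_ergodic_of_tartan_connection
    {S : Type} [TopologicalSpace S] [T2Space S] [CompactSpace S]
    [ChartedSpace (EuclideanHalfSpace 2) S] [MeasurableSpace S] [BorelSpace S]
    (μ : Measure S) [IsProbabilityMeasure μ] (hμ : IsOUMeasure μ)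
    (Ts Tu : MeasuredTurbulation μ) (F : S ≃ₜ S) (lam : ℝ)
    (hF : IsMPA μ F Ts Tu lam)
    (htch : ∀ R Q : Tartan Ts Tu, R.Compatible → 0 < μ R.core →
      Q.Compatible → 0 < μ Q.core →
      0 < μ (stableSaturation R ∩ unstableSaturation Q)) :
    ∀ A : Set S, MeasurableSet A → ⇑F '' A = A → μ A = 0 ∨ μ A = 1 := by
  intro A hA hFA
  have : SecondCountableTopology (EuclideanHalfSpace 2) :=
    TopologicalSpace.Subtype.secondCountableTopology _
  have : SecondCountableTopology S :=
    ChartedSpace.secondCountable_of_sigmaCompact (EuclideanHalfSpace 2) S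
  have : TopologicalSpace.MetrizableSpace S :=
    TopologicalSpace.metrizableSpace_of_t3_secondCountable S
  obtain ⟨-, hTs, hTu, hfull, -, -⟩ := hF.turbulations
  have hpre : ⇑F ⁻¹' A = A := by
    conv_lhs => rw [← hFA]
    exact F.injective.preimage_image A
  have hpre' : ⇑F.symm ⁻¹' A = A := by
    rw [← F.image_eq_preimage_symm, hFA]
  obtain ⟨B, hB, hBA, hBs⟩ := exists_saturated_ae_eq hTs F.continuous hF.measurePreserving
    hF.one_lt_lam subset_rfl (fun ℓ hℓ C x y hC n => hF.exists_stable_arc_iterate hℓ hC n)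
    hA hpre
  obtain ⟨C, hC, hCA, hCs⟩ := exists_saturated_ae_eq hTu F.symm.continuous
    hF.measurePreserving_symm hF.one_lt_lam IsMPA.backwardLines_subset
    (fun ℓ hℓ C x y hC n => hF.exists_unstable_arc_iterate hℓ hC n) hA hpre'
  set C' := C ∩ ⋃₀ IsMPA.backwardLines F Tu with hC'
  have hC'm : MeasurableSet C' := hC.inter hF.measurableSet_sUnion_backwardLines
  have hC'A : C' =ᵐ[μ] A := by
    refine EventuallyEq.trans ?_ hCA
    filter_upwards [hF.ae_mem_sUnion_backwardLines] with x hx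
    exact propext ⟨fun h => h.1, fun h => ⟨h, hx⟩⟩
  by_contra! hne
  have hpos := measure_inter_pos_of_tartan_connection hfull htch hB hBs
    (by rw [measure_congr hBA]; exact hne.1) hC'm.compl
    (IsMPA.isSaturated_inter_backwardLines hCs).compl
    (by rw [measure_congr hC'A.compl, Ne, prob_compl_eq_zero_iff hA]; exact hne.2)
  rw [measure_congr (hBA.inter hC'A.compl), Set.inter_compl_self, measure_empty] at hpos
  exact hpos.false

end
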